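/- If d is a base-3/2 digit string whose value v(d) is an integer, then ∑_i d(i+1) · (3/2)^i is also an integer; that is, removing the last digit of the base-3/2 representation of an integer gives the representation of another integer. -/

import Mathlib

/-- The value of a base-3/2 digit string. -/
def val32 (d : ℕ →₀ ℕ) : ℚ := d.sum fun i c => (c : ℚ) * (3 / 2 : ℚ) ^ i

/-- The value of a digit string as a sum over any initial range containing its support. -/
theorem val32_eq_sum_range (d : ℕ →₀ ℕ) {n : ℕ} (h : ∀ i, n ≤ i → d i = 0) :
    val32 d = ∑ i ∈ Finset.range n, (d i : ℚ) * (3 / 2 : ℚ) ^ i := by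
  refine Finsupp.sum_of_support_subset d (fun i hi => ?_) _ (by simp)
  by_contra hin
  exact Finsupp.mem_support_iff.mp hi (h i (by simpa using hin))

theorem exists_forall_ge_eq_zero (d : ℕ →₀ ℕ) : ∃ n, ∀ i, n ≤ i → d i = 0 := by
  refine ⟨d.support.sup id + 1, fun i hi => ?_⟩
  by_contra hne
  have := Finset.le_sup (f := id) (Finsupp.mem_support_iff.mpr hne)
  simp only [id] at this
  omega

theorem val32_eq_add_shift {d e : ℕ →₀ ℕ} (he : ∀ i, e i = d (i + 1)) :
    val32 d = d 0 + 3 / 2 * val32 e := by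
  obtain ⟨n, hn⟩ := exists_forall_ge_eq_zero d
  rw [val32_eq_sum_range d (n := n + 1) fun i hi => hn i (by omega),
    val32_eq_sum_range e (n := n) fun i hi => by rw [he]; exact hn _ (by omega),
    Finset.sum_range_succ', Finset.mul_sum, add_comm]
  congr 1
  · simp
  · exact Finset.sum_congr rfl fun i _ => by rw [he]; ring

/-- A partial sum of a base-3/2 expansion is a dyadic rational. -/
theorem exists_two_pow_mul_sum_eq_int (c : ℕ → ℕ) (n : ℕ) :
    ∃ z : ℤ, 2 ^ n * ∑ i ∈ Finset.range n, (c i : ℚ) * (3 / 2 : ℚ) ^ i = z := by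
  induction n with
  | zero => exact ⟨0, by simp⟩
  | succ n ih =>
    obtain ⟨z, hz⟩ := ih
    refine ⟨2 * z + 2 * (c n * 3 ^ n), ?_⟩
    rw [Finset.sum_range_succ]
    push_cast
    rw [← hz, div_pow]
    field_simp
    ring

/-- Removing the last digit of the base-3/2 representation of an integer gives
another integer: if `v(d)` is an integer, so is `∑ i, d (i+1) * (3/2)^i`. -/
theorem base32_drop_last_digit_integer (d : ℕ →₀ ℕ) (hd : ∀ i, d i ≤ 2)
    (N : ℤ) (hval : val32 d = N)
    (e : ℕ →₀ ℕ) (he : ∀ i, e i = d (i + 1)) :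
    ∃ M : ℤ, val32 e = M := by
  obtain ⟨n, hn⟩ := exists_forall_ge_eq_zero e
  obtain ⟨z, hz⟩ := exists_two_pow_mul_sum_eq_int e n
  rw [← val32_eq_sum_range e hn] at hz
  have hthree : 3 * val32 e = ((2 * (N - d 0) : ℤ) : ℚ) := by
    have := val32_eq_add_shift he
    push_cast
    linarith
  have hdvd : (3 : ℤ) ∣ 2 ^ n * (2 * (N - d 0)) := by
    refine ⟨z, ?_⟩
    have : (2 : ℚ) ^ n * ((2 * (N - d 0) : ℤ) : ℚ) = 3 * z := by
      rw [← hthree, ← hz]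
      ring
    exact_mod_cast this
  have hcop : IsCoprime (3 : ℤ) (2 ^ n) := IsCoprime.pow_right ⟨1, -1, by norm_num⟩
  obtain ⟨M, hM⟩ := hcop.dvd_of_dvd_mul_left hdvd
  refine ⟨M, ?_⟩
  rw [hM] at hthree
  push_cast at hthree
  linarith
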